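/- Let A ∈ M_{m,n}(ℝ) with (y_k) a sequence of weighted best approximations to A^T, Y_k = ‖y_k‖_r, M_k = inf_q ‖A^T y_k − q‖_s. Then A^T is singular on average if and only if for every ε > 0, lim_{k→∞} (1/log Y_k) |{i ≤ k : M_i Y_{i+1} > ε}| = 0. -/

import Mathlib

open Filter Topology

/-- The weighted `w`-quasinorm `‖x‖_w = max_i |x_i|^{1/w_i}` on `ℝ^k`. -/
noncomputable def qnorm {k : ℕ} (hk : 0 < k) (w : Fin k → ℝ) (x : Fin k → ℝ) : ℝ :=
  Finset.univ.sup' (Finset.univ_nonempty_iff.mpr (Fin.pos_iff_nonempty.mp hk))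
    (fun i => |x i| ^ (w i)⁻¹)

/-- `⟨x⟩_w = inf_{p ∈ ℤ^k} ‖x − p‖_w`, the quasinorm distance to the integer lattice. -/
noncomputable def idist {k : ℕ} (hk : 0 < k) (w : Fin k → ℝ) (x : Fin k → ℝ) : ℝ :=
  ⨅ p : Fin k → ℤ, qnorm hk w (fun i => x i - (p i : ℝ))

/-- `A ∈ M_{m,n}(ℝ)` is singular on average (with weights `r`, `s`). -/
noncomputable def SingularOnAverage {m n : ℕ} (hm : 0 < m) (hn : 0 < n)
    (r : Fin m → ℝ) (s : Fin n → ℝ) (A : Matrix (Fin m) (Fin n) ℝ) : Prop :=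
  ∀ ε : ℝ, 0 < ε →
    Filter.Tendsto (fun N : ℕ =>
      (({l : ℕ | 1 ≤ l ∧ l ≤ N ∧ ∃ q : Fin n → ℤ,
          idist hm r (fun i => ∑ j, A i j * (q j : ℝ)) < ε * 2 ^ (-(l : ℝ)) ∧
          0 < qnorm hn s (fun j => (q j : ℝ)) ∧
          qnorm hn s (fun j => (q j : ℝ)) < 2 ^ (l : ℝ)}.ncard : ℝ) / N))
      Filter.atTop (𝓝 1)

lemma card_le_of_close (F : Finset ℕ) (D : ℕ) (h : ∀ a ∈ F, ∀ b ∈ F, b < a + D) : F.card ≤ D := by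
  rcases F.eq_empty_or_nonempty with rfl | hF
  · simp
  · have : F ⊆ Finset.Ico (F.min' hF) (F.min' hF + D) := by
      intro b hb
      rw [Finset.mem_Ico]
      exact ⟨F.min'_le b hb, h _ (F.min'_mem hF) _ hb⟩
    simpa using Finset.card_le_card this

open Classical in
lemma ncard_eq_filter (P : ℕ → Prop) (N : ℕ) :
    {l : ℕ | 1 ≤ l ∧ l ≤ N ∧ P l}.ncard = ((Finset.Icc 1 N).filter P).card := by
  rw [← Set.ncard_coe_finset]
  congr 1
  ext l
  simp [and_assoc]

open Classical in
lemma countA (Y M : ℕ → ℝ)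
    (hMpos : ∀ k, 0 < M k) (C : ℝ) (hC : ∀ k, M k * Y (k+1) ≤ C)
    (G : ℕ → Prop) (ε : ℝ) (hε : 0 < ε)
    (h2 : ∀ l i, Y i < 2 ^ l → M i * 2 ^ l < ε → G l) :
    ∃ D : ℕ, ∀ N k, 2 ^ N ≤ Y (k+1) →
      ((Finset.Icc 1 N).filter (fun l => ¬ G l)).card ≤
        D + D * ((Finset.Icc 1 k).filter (fun i => ε / 2 < M i * Y (i+1))).card := by
  obtain ⟨D1, hD1⟩ := pow_unbounded_of_one_lt (C / ε) (one_lt_two : (1:ℝ) < 2)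
  obtain ⟨D2, hD2⟩ := pow_unbounded_of_one_lt (Y 1) (one_lt_two : (1:ℝ) < 2)
  refine ⟨D1 + D2, fun N k hN => ?_⟩
  set S := (Finset.Icc 1 k).filter (fun i => ε / 2 < M i * Y (i+1)) with hS
  set f : ℕ → Finset ℕ := fun i =>
    (Finset.Icc 1 N).filter (fun l => ε ≤ M i * 2 ^ l ∧ (2:ℝ) ^ l ≤ Y (i+1)) with hf
  have hsub : (Finset.Icc 1 N).filter (fun l => ¬ G l) ⊆ Finset.range D2 ∪ S.biUnion f := by
    intro l hl
    simp only [Finset.mem_filter, Finset.mem_Icc] at hl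
    obtain ⟨⟨hl1, hlN⟩, hG⟩ := hl
    rw [Finset.mem_union]
    by_cases hlD : l < D2
    · left; simpa using hlD
    right
    have hpl : (2:ℝ) ^ D2 ≤ 2 ^ l := pow_le_pow_right₀ (by norm_num) (by omega)
    have hpN : (2:ℝ) ^ l ≤ 2 ^ N := pow_le_pow_right₀ (by norm_num) hlN
    have hex : ∃ j, (2:ℝ) ^ l ≤ Y (j+1) := ⟨k, hpN.trans hN⟩
    set i := Nat.find hex with hi
    have hi1 : (2:ℝ) ^ l ≤ Y (i+1) := Nat.find_spec hex
    have hik : i ≤ k := Nat.find_min' hex (hpN.trans hN)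
    have hi0 : i ≠ 0 := by
      intro h0
      rw [h0] at hi1
      simp at hi1
      linarith
    have hYi : Y i < 2 ^ l := by
      have := Nat.find_min hex (m := i - 1) (by omega)
      rw [Nat.sub_add_cancel (by omega)] at this
      linarith
    have hM : ε ≤ M i * 2 ^ l := by
      by_contra h
      exact hG (h2 l i hYi (by linarith))
    rw [Finset.mem_biUnion]
    refine ⟨i, ?_, ?_⟩
    · rw [hS, Finset.mem_filter, Finset.mem_Icc]
      refine ⟨⟨by omega, hik⟩, ?_⟩
      have := mul_le_mul_of_nonneg_left hi1 (hMpos i).le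
      linarith
    · rw [hf]
      simp only [Finset.mem_filter, Finset.mem_Icc]
      exact ⟨⟨hl1, hlN⟩, hM, hi1⟩
  have hfc : ∀ i ∈ S, (f i).card ≤ D1 := by
    intro i _
    apply card_le_of_close
    intro a ha b hb
    simp only [hf, Finset.mem_filter, Finset.mem_Icc] at ha hb
    by_contra hab
    have h1 : (2:ℝ) ^ (a + D1) ≤ 2 ^ b := pow_le_pow_right₀ (by norm_num) (by omega)
    rw [pow_add] at h1
    have h3 : M i * 2 ^ b ≤ C := (mul_le_mul_of_nonneg_left hb.2.2 (hMpos i).le).trans (hC i)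
    have h4 : M i * (2 ^ a * 2 ^ D1) ≤ M i * 2 ^ b := mul_le_mul_of_nonneg_left h1 (hMpos i).le
    rw [div_lt_iff₀ hε] at hD1
    have h5 : ε * 2 ^ D1 ≤ M i * 2 ^ a * 2 ^ D1 :=
      mul_le_mul_of_nonneg_right ha.2.1 (by positivity)
    linarith
  have h1 := Finset.card_le_card hsub
  have h3 := Finset.card_union_le (Finset.range D2) (S.biUnion f)
  have h4 := Finset.card_biUnion_le_card_mul S f D1 hfc
  rw [Finset.card_range] at h3
  nlinarith

open Classical in
lemma countB (Y M : ℕ → ℝ) (hYmono : StrictMono Y) (hY1 : 1 ≤ Y 0)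
    (hMpos : ∀ k, 0 < M k) (V : ℕ) (hV : ∀ k, 2 * Y (k+1) ≤ Y (k + 1 + V))
    (G : ℕ → Prop) (ε : ℝ)
    (h1 : ∀ l i, 2 ^ l ≤ Y (i+1) → G l → M i * 2 ^ l < ε / 2) (N k : ℕ)
    (hk : Y k < 2 ^ (N+1)) :
    ((Finset.Icc 1 k).filter (fun i => ε < M i * Y (i+1))).card ≤
      1 + V * (1 + ((Finset.Icc 1 N).filter (fun l => ¬ G l)).card) := by
  set B := (Finset.Icc 1 N).filter (fun l => ¬ G l) with hB
  set f : ℕ → Finset ℕ := fun l =>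
    (Finset.Icc 1 k).filter (fun i => (2:ℝ) ^ l ≤ Y (i+1) ∧ Y (i+1) < 2 ^ (l+1)) with hf
  have hsub : (Finset.Icc 1 k).filter (fun i => ε < M i * Y (i+1)) ⊆
      {k} ∪ ({0} ∪ B).biUnion f := by
    intro i hi
    simp only [Finset.mem_filter, Finset.mem_Icc] at hi
    obtain ⟨⟨hi1, hik⟩, hi2⟩ := hi
    rw [Finset.mem_union]
    by_cases hik' : i = k
    · left; simpa using hik'
    right
    have hYi : 1 ≤ Y (i+1) := hY1.trans (hYmono.monotone (Nat.zero_le _))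
    obtain ⟨l, hl1, hl2⟩ := exists_nat_pow_near hYi (one_lt_two : (1:ℝ) < 2)
    rw [Finset.mem_biUnion]
    refine ⟨l, ?_, ?_⟩
    · rw [Finset.mem_union]
      by_cases hl0 : l = 0
      · left; simpa using hl0
      right
      rw [hB, Finset.mem_filter, Finset.mem_Icc]
      refine ⟨⟨by omega, ?_⟩, ?_⟩
      · have : Y (i+1) ≤ Y k := hYmono.monotone (by omega)
        have h : (2:ℝ) ^ l < 2 ^ (N+1) := by linarith
        have := (pow_lt_pow_iff_right₀ (one_lt_two : (1:ℝ) < 2)).1 h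
        omega
      · intro hG
        have h3 := h1 l i hl1 hG
        rw [pow_succ] at hl2
        have := mul_lt_mul_of_pos_left hl2 (hMpos i)
        linarith
    · simp only [hf, Finset.mem_filter, Finset.mem_Icc]
      exact ⟨⟨hi1, hik⟩, hl1, hl2⟩
  have hfc : ∀ l ∈ ({0} ∪ B), (f l).card ≤ V := by
    intro l _
    apply card_le_of_close
    intro a ha b hb
    simp only [hf, Finset.mem_filter, Finset.mem_Icc] at ha hb
    by_contra hab
    have h3 : Y (a + 1 + V) ≤ Y (b+1) := hYmono.monotone (by omega)
    have h4 := hV a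
    have h5 := hb.2.2
    rw [pow_succ] at h5
    linarith [ha.2.1]
  have h1 := Finset.card_le_card hsub
  have h3 := Finset.card_union_le {k} (({0} ∪ B).biUnion f)
  have h4 := Finset.card_biUnion_le_card_mul _ f V hfc
  have h5 := Finset.card_union_le {0} B
  rw [Finset.card_singleton] at h3 h5
  have h6 := Nat.mul_le_mul_left V h5
  rw [mul_comm] at h4
  omega

open Classical in
lemma good_iff_bad (G : ℕ → Prop) :
    Tendsto (fun N : ℕ => (({l : ℕ | 1 ≤ l ∧ l ≤ N ∧ G l}.ncard : ℝ) / N)) atTop (𝓝 1) ↔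
    Tendsto (fun N : ℕ => ((((Finset.Icc 1 N).filter (fun l => ¬ G l)).card : ℝ) / N))
      atTop (𝓝 0) := by
  have key : ∀ᶠ N : ℕ in atTop, (({l : ℕ | 1 ≤ l ∧ l ≤ N ∧ G l}.ncard : ℝ) / N) =
      1 - ((((Finset.Icc 1 N).filter (fun l => ¬ G l)).card : ℝ) / N) := by
    filter_upwards [eventually_gt_atTop 0] with N hN
    rw [ncard_eq_filter]
    have h := Finset.card_filter_add_card_filter_not (s := Finset.Icc 1 N) G
    rw [Nat.card_Icc, Nat.add_sub_cancel] at h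
    have h' : (((Finset.Icc 1 N).filter G).card : ℝ) +
      ((Finset.Icc 1 N).filter (fun l => ¬ G l)).card = N := by exact_mod_cast h
    have : (0:ℝ) < N := by exact_mod_cast hN
    field_simp
    linarith
  rw [tendsto_congr' key]
  constructor
  · intro h
    simpa using h.const_sub 1
  · intro h
    simpa using h.const_sub 1

lemma abstract_iff (Y M : ℕ → ℝ) (hYmono : StrictMono Y) (hY1 : 1 ≤ Y 0)
    (hYtop : Tendsto Y atTop atTop)
    (hMpos : ∀ k, 0 < M k) (C : ℝ) (hC : ∀ k, M k * Y (k+1) ≤ C)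
    (V : ℕ) (hV : ∀ k, 2 * Y (k+1) ≤ Y (k + 1 + V))
    (G : ℝ → ℕ → Prop)
    (h1 : ∀ ε l i, 2 ^ l ≤ Y (i+1) → G ε l → M i * 2 ^ l < ε)
    (h2 : ∀ ε l i, Y i < 2 ^ l → M i * 2 ^ l < ε → G ε l) :
    (∀ ε : ℝ, 0 < ε → Tendsto (fun N : ℕ =>
      (({l : ℕ | 1 ≤ l ∧ l ≤ N ∧ G ε l}.ncard : ℝ) / N)) atTop (𝓝 1)) ↔
    (∀ ε : ℝ, 0 < ε → Tendsto (fun k : ℕ =>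
      (({i : ℕ | 1 ≤ i ∧ i ≤ k ∧ ε < M i * Y (i + 1)}.ncard : ℝ) / Real.log (Y k)))
          atTop (𝓝 0)) := by
  classical
  simp_rw [good_iff_bad]
  simp_rw [ncard_eq_filter]
  have hlogpos : ∀ k, 1 ≤ k → 0 < Real.log (Y k) := fun k hk =>
    Real.log_pos (lt_of_le_of_lt hY1 (hYmono (by omega)))
  have hlogtop : Tendsto (fun k => Real.log (Y k)) atTop atTop := Real.tendsto_log_atTop.comp hYtop
  have hl2 : 0 < Real.log 2 := Real.log_pos (by norm_num)
  have hl21 : Real.log 2 ≤ 1 := by linarith [Real.log_two_lt_d9]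
  constructor
  · intro h ε hε
    have hN : ∀ k, ∃ N : ℕ, (2:ℝ) ^ N ≤ Y k ∧ Y k < 2 ^ (N+1) := fun k =>
      exists_nat_pow_near (hY1.trans (hYmono.monotone (Nat.zero_le _))) one_lt_two
    choose N hN1 hN2 using hN
    have hNtop : Tendsto N atTop atTop := by
      rw [tendsto_atTop]
      intro b
      filter_upwards [hYtop.eventually_ge_atTop (2 ^ b)] with k hk
      have : (2:ℝ) ^ b < 2 ^ (N k + 1) := lt_of_le_of_lt hk (hN2 k)
      have := (pow_lt_pow_iff_right₀ (one_lt_two : (1:ℝ) < 2)).1 this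
      omega
    have hcomp := (h (ε/2) (by positivity)).comp hNtop
    have hlim : Tendsto (fun k => (1 + V : ℝ) / Real.log (Y k) +
        V / Real.log 2 * ((((Finset.Icc 1 (N k)).filter (fun l => ¬ G (ε/2) l)).card : ℝ) / (N k)))
        atTop (𝓝 0) := by
      have := (hlogtop.const_div_atTop (1 + V : ℝ)).add (hcomp.const_mul (V / Real.log 2 : ℝ))
      simpa using this
    refine squeeze_zero' ?_ ?_ hlim
    · filter_upwards [eventually_ge_atTop 1] with k hk
      have := hlogpos k hk
      positivity
    · filter_upwards [eventually_ge_atTop 1, hNtop.eventually_ge_atTop 1] with k hk hNk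
      have hlog := hlogpos k hk
      have hc := countB Y M hYmono hY1 hMpos V hV (G (ε/2)) ε (fun l i => h1 (ε/2) l i)
        (N k) k (hN2 k)
      have hc' : (((Finset.Icc 1 k).filter (fun i => ε < M i * Y (i+1))).card : ℝ) ≤
        1 + V * (1 + ((Finset.Icc 1 (N k)).filter (fun l => ¬ G (ε/2) l)).card) := by
        exact_mod_cast hc
      set b : ℝ := (((Finset.Icc 1 (N k)).filter (fun l => ¬ G (ε/2) l)).card : ℝ) with hb
      have hb0 : 0 ≤ b := by positivity
      have hNpos : (0:ℝ) < N k := by exact_mod_cast hNk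
      have hle : N k * Real.log 2 ≤ Real.log (Y k) := by
        rw [← Real.log_pow]
        exact Real.log_le_log (by positivity) (hN1 k)
      calc _ ≤ (1 + V * (1 + b)) / Real.log (Y k) := by gcongr
        _ = (1 + V : ℝ) / Real.log (Y k) + V * b / Real.log (Y k) := by ring
        _ ≤ (1 + V : ℝ) / Real.log (Y k) + V * b / (N k * Real.log 2) := by gcongr
        _ = _ := by field_simp
  · intro h ε hε
    obtain ⟨D, hD⟩ := countA Y M hMpos C hC (G ε) ε hε (h2 ε)
    have hex : ∀ N : ℕ, ∃ j, (2:ℝ) ^ N ≤ Y (j+1) := fun N => by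
      obtain ⟨j, hj⟩ := (hYtop.eventually_ge_atTop ((2:ℝ)^N)).exists
      exact ⟨j, hj.trans (hYmono.monotone (by omega))⟩
    set K : ℕ → ℕ := fun N => Nat.find (hex N) with hK
    have hK1 : ∀ N, (2:ℝ) ^ N ≤ Y (K N + 1) := fun N => Nat.find_spec (hex N)
    have hK2 : ∀ N, 1 ≤ K N → Y (K N) < 2 ^ N := fun N hN => by
      have := Nat.find_min (hex N) (m := K N - 1) (by simp only [hK] at hN ⊢; omega)
      rw [Nat.sub_add_cancel hN] at this
      linarith
    have hKtop : Tendsto K atTop atTop := by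
      rw [tendsto_atTop]
      intro b
      have : Tendsto (fun N : ℕ => (2:ℝ) ^ N) atTop atTop :=
        tendsto_pow_atTop_atTop_of_one_lt one_lt_two
      filter_upwards [this.eventually_gt_atTop (Y b)] with N hN
      have := hYmono.lt_iff_lt.1 (lt_of_lt_of_le hN (hK1 N))
      omega
    have hcomp := (h (ε/2) (by positivity)).comp hKtop
    have hlim : Tendsto (fun N : ℕ => (D : ℝ) / N +
        D * ((((Finset.Icc 1 (K N)).filter (fun i => ε/2 < M i * Y (i+1))).card : ℝ)
          / Real.log (Y (K N)))) atTop (𝓝 0) := by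
      have := (tendsto_natCast_atTop_atTop (R := ℝ)).const_div_atTop (D : ℝ) |>.add
        (hcomp.const_mul (D : ℝ))
      simpa using this
    refine squeeze_zero' ?_ ?_ hlim
    · filter_upwards with k
      positivity
    · filter_upwards [eventually_ge_atTop 1, hKtop.eventually_ge_atTop 1] with N hN hKN
      have hlog := hlogpos (K N) hKN
      have hc' : (((Finset.Icc 1 N).filter (fun l => ¬ G ε l)).card : ℝ) ≤
        D + D * ((Finset.Icc 1 (K N)).filter (fun i => ε/2 < M i * Y (i+1))).card := by
        exact_mod_cast hD N (K N) (hK1 N)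
      set b : ℝ := (((Finset.Icc 1 (K N)).filter (fun i => ε/2 < M i * Y (i+1))).card : ℝ) with hb
      have hb0 : 0 ≤ b := by positivity
      have hNpos : (0:ℝ) < N := by exact_mod_cast hN
      have hle : Real.log (Y (K N)) ≤ N := by
        have h3 : Real.log (Y (K N)) ≤ Real.log (2 ^ N) :=
          Real.log_le_log (by linarith [hYmono.monotone (Nat.zero_le (K N))]) (hK2 N hKN).le
        rw [Real.log_pow] at h3
        nlinarith
      calc _ ≤ (D + D * b) / N := by gcongr
        _ = (D : ℝ) / N + D * (b / N) := by ring
        _ ≤ _ := by gcongr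

lemma qnorm_le_iff {k : ℕ} (hk : 0 < k) (w : Fin k → ℝ) (hw : ∀ i, 0 < w i) (x : Fin k → ℝ)
    (T : ℝ) (hT : 0 ≤ T) : qnorm hk w x ≤ T ↔ ∀ i, |x i| ≤ T ^ (w i) := by
  unfold qnorm
  rw [Finset.sup'_le_iff]
  simp only [Finset.mem_univ, true_imp_iff]
  exact forall_congr' fun i => Real.rpow_inv_le_iff_of_pos (abs_nonneg _) hT (hw i)

lemma qnorm_lt_iff {k : ℕ} (hk : 0 < k) (w : Fin k → ℝ) (hw : ∀ i, 0 < w i) (x : Fin k → ℝ)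
    (T : ℝ) (hT : 0 ≤ T) : qnorm hk w x < T ↔ ∀ i, |x i| < T ^ (w i) := by
  unfold qnorm
  rw [Finset.sup'_lt_iff]
  simp only [Finset.mem_univ, true_imp_iff]
  exact forall_congr' fun i => Real.rpow_inv_lt_iff_of_pos (abs_nonneg _) hT (hw i)

lemma qnorm_nonneg {k : ℕ} (hk : 0 < k) (w : Fin k → ℝ) (x : Fin k → ℝ) :
    0 ≤ qnorm hk w x := by
  unfold qnorm
  rw [Finset.le_sup'_iff]
  exact ⟨⟨0, hk⟩, Finset.mem_univ _, by positivity⟩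

lemma one_le_qnorm {k : ℕ} (hk : 0 < k) (w : Fin k → ℝ) (hw : ∀ i, 0 < w i) (z : Fin k → ℤ)
    (hz : z ≠ 0) : 1 ≤ qnorm hk w (fun i => (z i : ℝ)) := by
  obtain ⟨i, hi⟩ := Function.ne_iff.1 hz
  unfold qnorm
  rw [Finset.le_sup'_iff]
  refine ⟨i, Finset.mem_univ _, Real.one_le_rpow ?_ (inv_nonneg.2 (hw i).le)⟩
  have h : 1 ≤ |z i| := Int.one_le_abs hi
  show (1:ℝ) ≤ |(z i : ℝ)|
  exact_mod_cast h

lemma idist_le {k : ℕ} (hk : 0 < k) (w : Fin k → ℝ) (x : Fin k → ℝ) (p : Fin k → ℤ) :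
    idist hk w x ≤ qnorm hk w (fun i => x i - (p i : ℝ)) := by
  unfold idist
  exact ciInf_le ⟨0, by rintro _ ⟨p, rfl⟩; exact qnorm_nonneg _ _ _⟩ p

lemma idist_eq {k : ℕ} (hk : 0 < k) (w : Fin k → ℝ) (hw : ∀ i, 0 < w i) (x : Fin k → ℝ) :
    idist hk w x = qnorm hk w (fun i => x i - (round (x i) : ℝ)) := by
  refine le_antisymm (idist_le hk w x (fun i => round (x i))) ?_
  unfold idist
  refine le_ciInf fun p => ?_
  rw [qnorm_le_iff hk w hw _ _ (qnorm_nonneg _ _ _)]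
  intro i
  exact (round_le (x i) (p i)).trans
    ((qnorm_le_iff hk w hw (fun i => x i - (p i : ℝ)) _ (qnorm_nonneg _ _ _)).1 le_rfl i)

lemma idist_nonneg {k : ℕ} (hk : 0 < k) (w : Fin k → ℝ) (x : Fin k → ℝ) :
    0 ≤ idist hk w x := Real.iInf_nonneg fun _ => qnorm_nonneg _ _ _

lemma idist_le_one {k : ℕ} (hk : 0 < k) (w : Fin k → ℝ) (hw : ∀ i, 0 < w i) (x : Fin k → ℝ) :
    idist hk w x ≤ 1 := by
  rw [idist_eq hk w hw, qnorm_le_iff hk w hw _ _ zero_le_one]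
  intro i
  rw [Real.one_rpow]
  linarith [abs_sub_round (x i)]

lemma sum_sub_eq {m n : ℕ} (A : Matrix (Fin m) (Fin n) ℝ) (a b : Fin m → ℤ) (j : Fin n) :
    ∑ i, A i j * (((a i - b i : ℤ)) : ℝ) = ∑ i, A i j * (a i : ℝ) - ∑ i, A i j * (b i : ℝ) := by
  rw [← Finset.sum_sub_distrib]
  refine Finset.sum_congr rfl fun i _ => ?_
  push_cast
  ring

/-- Weighted Dirichlet theorem, with a non-optimal constant. -/
lemma dirichlet {m n : ℕ} (hm : 0 < m) (hn : 0 < n) (r : Fin m → ℝ) (s : Fin n → ℝ)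
    (hrpos : ∀ i, 0 < r i) (hspos : ∀ j, 0 < s j)
    (hrsum : ∑ i, r i = 1) (hssum : ∑ j, s j = 1) (A : Matrix (Fin m) (Fin n) ℝ)
    (T δ : ℝ) (hT : 0 < T) (hδ : 0 < δ) (hδ1 : δ ≤ 1) (h : 2 ^ n ≤ T * δ) :
    ∃ z : Fin m → ℤ, z ≠ 0 ∧ qnorm hm r (fun i => (z i : ℝ)) ≤ T ∧
      idist hn s (fun j => ∑ i, A i j * (z i : ℝ)) ≤ δ := by
  set Q : Fin n → ℕ := fun j => ⌈(δ ^ s j)⁻¹⌉₊ with hQ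
  have hδs : ∀ j, 0 < δ ^ s j := fun j => Real.rpow_pos_of_pos hδ _
  have hδs1 : ∀ j, 1 ≤ (δ ^ s j)⁻¹ := fun j =>
    (one_le_inv₀ (hδs j)).2 (Real.rpow_le_one hδ.le hδ1 (hspos j).le)
  have hQ1 : ∀ j, (δ ^ s j)⁻¹ ≤ Q j := fun j => Nat.le_ceil _
  have hQ2 : ∀ j, (Q j : ℝ) ≤ 2 * (δ ^ s j)⁻¹ := fun j => by
    have := Nat.ceil_lt_add_one (inv_nonneg.2 (hδs j).le)
    have := hδs1 j
    simp only [hQ]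
    linarith
  have hQ0 : ∀ j, (0:ℝ) < Q j := fun j => by linarith [hQ1 j, hδs1 j]
  set x : (Fin m → ℕ) → Fin n → ℝ := fun a j => ∑ i, A i j * (((a i : ℤ)) : ℝ) with hx
  set S : Finset (Fin m → ℕ) := Fintype.piFinset fun i => Finset.range (⌊T ^ r i⌋₊ + 1) with hS
  set U : Finset (Fin n → ℕ) := Fintype.piFinset fun j => Finset.range (Q j) with hU
  have hcard : U.card < S.card := by
    have h1 : (U.card : ℝ) ≤ 2 ^ n * δ⁻¹ := by
      simp only [hU, Fintype.card_piFinset, Finset.card_range]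
      push_cast
      calc ∏ j, (Q j : ℝ) ≤ ∏ j, (2 * (δ ^ s j)⁻¹) :=
            Finset.prod_le_prod (fun j _ => (hQ0 j).le) (fun j _ => hQ2 j)
        _ = 2 ^ n * δ⁻¹ := by
            rw [Finset.prod_mul_distrib, Finset.prod_inv_distrib, ← Real.rpow_sum_of_pos hδ, hssum]
            simp
    have h2 : T < S.card := by
      simp only [hS, Fintype.card_piFinset, Finset.card_range]
      push_cast
      have : T = ∏ i, T ^ r i := by rw [← Real.rpow_sum_of_pos hT, hrsum, Real.rpow_one]
      calc T = ∏ i, T ^ r i := this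
        _ < _ := Finset.prod_lt_prod_of_nonempty (fun i _ => Real.rpow_pos_of_pos hT _)
            (fun i _ => Nat.lt_floor_add_one _) ⟨⟨0, hm⟩, Finset.mem_univ _⟩
    have h3 : 2 ^ n * δ⁻¹ ≤ T := by
      rw [← div_eq_mul_inv, div_le_iff₀ hδ]; exact h
    exact_mod_cast lt_of_le_of_lt (h1.trans h3) h2
  obtain ⟨a, ha, b, hb, hab, hfab⟩ := Finset.exists_ne_map_eq_of_card_lt_of_maps_to hcard
    (f := fun a j => ⌊Int.fract (x a j) * Q j⌋₊) (by
      intro a _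
      simp only [hU, Finset.mem_coe, Fintype.mem_piFinset, Finset.mem_range]
      intro j
      rw [Nat.floor_lt (mul_nonneg (Int.fract_nonneg _) (hQ0 j).le)]
      exact mul_lt_of_lt_one_left (hQ0 j) (Int.fract_lt_one _))
  simp only [hS, Fintype.mem_piFinset, Finset.mem_range] at ha hb
  refine ⟨fun i => (a i : ℤ) - (b i : ℤ), ?_, ?_, ?_⟩
  · intro h0
    apply hab
    funext i
    have := congrFun h0 i
    simp at this
    omega
  · rw [qnorm_le_iff hm r hrpos _ _ hT.le]
    intro i
    have hTi : 0 ≤ T ^ r i := Real.rpow_nonneg hT.le _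
    have h1 : (a i : ℝ) ≤ T ^ r i := (Nat.le_floor_iff hTi).1 (Nat.lt_succ_iff.1 (ha i))
    have h2 : (b i : ℝ) ≤ T ^ r i := (Nat.le_floor_iff hTi).1 (Nat.lt_succ_iff.1 (hb i))
    have h3 : (0:ℝ) ≤ a i := by positivity
    have h4 : (0:ℝ) ≤ b i := by positivity
    push_cast
    rw [abs_le]
    constructor <;> linarith
  · refine (idist_le hn s _ (fun j => ⌊x a j⌋ - ⌊x b j⌋)).trans ?_
    rw [qnorm_le_iff hn s hspos _ _ hδ.le]
    intro j
    have h1 := congrFun hfab j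
    have h2 : ⌊Int.fract (x a j) * Q j⌋ = ⌊Int.fract (x b j) * Q j⌋ := by
      rw [← Int.natCast_floor_eq_floor (mul_nonneg (Int.fract_nonneg _) (hQ0 j).le),
        ← Int.natCast_floor_eq_floor (mul_nonneg (Int.fract_nonneg _) (hQ0 j).le), h1]
    have h3 := Int.abs_sub_lt_one_of_floor_eq_floor h2
    rw [← sub_mul, abs_mul, abs_of_pos (hQ0 j)] at h3
    have h4 : (∑ i, A i j * (((a i : ℤ) - (b i : ℤ) : ℤ) : ℝ)) - ((⌊x a j⌋ - ⌊x b j⌋ : ℤ) : ℝ)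
        = Int.fract (x a j) - Int.fract (x b j) := by
      rw [sum_sub_eq A (fun i => (a i : ℤ)) (fun i => (b i : ℤ)) j]
      simp only [Int.fract, hx]
      push_cast
      ring
    rw [h4]
    have h5 := mul_le_mul_of_nonneg_left (hQ1 j)
      (abs_nonneg (Int.fract (x a j) - Int.fract (x b j)))
    have h6 : |Int.fract (x a j) - Int.fract (x b j)| * (δ ^ s j)⁻¹ ≤ 1 := by linarith
    rwa [← div_eq_mul_inv, div_le_one (hδs j)] at h6

/-- Doubling property of the best approximation denominators. -/
lemma doubling {m n : ℕ} (hm : 0 < m) (hn : 0 < n) (r : Fin m → ℝ) (s : Fin n → ℝ)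
    (hrpos : ∀ i, 0 < r i) (hspos : ∀ j, 0 < s j)
    (hrsum : ∑ i, r i = 1) (A : Matrix (Fin m) (Fin n) ℝ)
    (y : ℕ → Fin m → ℤ) (hy0 : ∀ k, y k ≠ 0)
    (Y M : ℕ → ℝ)
    (hY : ∀ k, Y k = qnorm hm r (fun i => (y k i : ℝ)))
    (hM : ∀ k, M k = idist hn s (fun j => ∑ i, A i j * (y k i : ℝ)))
    (hYmono : StrictMono Y) (hManti : StrictAnti M)
    (hbest : ∀ k, ∀ z : Fin m → ℤ, z ≠ 0 →
      qnorm hm r (fun i => (z i : ℝ)) < Y (k + 1) →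
      M k ≤ idist hn s (fun j => ∑ i, A i j * (z i : ℝ))) (k : ℕ) :
    2 * Y (k+1) ≤ Y (k + 1 + 4 ^ m * 2 ^ n) := by
  by_contra hcon
  push Not at hcon
  set V := 4 ^ m * 2 ^ n with hV
  set X := Y (k+1) with hX
  have hXpos : 0 < X := by
    have := one_le_qnorm hm r hrpos (y (k+1)) (hy0 _)
    rw [← hY] at this
    linarith
  have hXr : ∀ i, 0 < X ^ r i := fun i => Real.rpow_pos_of_pos hXpos _
  have hM0 : 0 ≤ M (k+1) := by rw [hM]; exact idist_nonneg _ _ _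
  set x : ℕ → Fin n → ℝ := fun a j => ∑ i, A i j * (y a i : ℝ) with hx
  set e : ℕ → Fin n → ℝ := fun a j => x a j - round (x a j) with he
  set U : Finset ((Fin m → ℤ) × (Fin n → Bool)) :=
    (Fintype.piFinset fun _ => Finset.Icc (-2 : ℤ) 1) ×ˢ Finset.univ with hU
  have hUc : U.card = V := by
    simp [hU, hV]
  have hsmall : ∀ a ∈ Finset.Icc (k+1) (k+1+V), ∀ i, |(y a i : ℝ)| < 2 * X ^ r i := by
    intro a ha i
    rw [Finset.mem_Icc] at ha
    have h1 : Y a < 2 * X := lt_of_le_of_lt (hYmono.monotone ha.2) hcon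
    rw [hY, qnorm_lt_iff hm r hrpos _ _ (by positivity)] at h1
    refine (h1 i).trans_le ?_
    rw [Real.mul_rpow (by norm_num) hXpos.le]
    have hr1 : r i ≤ 1 := by
      rw [← hrsum]
      exact Finset.single_le_sum (fun i _ => (hrpos i).le) (Finset.mem_univ i)
    have : (2:ℝ) ^ r i ≤ 2 := by
      conv_rhs => rw [← Real.rpow_one 2]
      exact Real.rpow_le_rpow_of_exponent_le (by norm_num) hr1
    exact mul_le_mul_of_nonneg_right this (hXr i).le
  have hesmall : ∀ a ∈ Finset.Icc (k+1) (k+1+V), ∀ j, |e a j| ≤ M (k+1) ^ s j := by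
    intro a ha j
    rw [Finset.mem_Icc] at ha
    have h1 : M a ≤ M (k+1) := hManti.antitone ha.1
    rw [hM a, idist_eq hn s hspos, qnorm_le_iff hn s hspos _ _ hM0] at h1
    exact h1 j
  obtain ⟨a, ha, b, hb, hab, hfab⟩ := Finset.exists_ne_map_eq_of_card_lt_of_maps_to
    (s := Finset.Icc (k+1) (k+1+V)) (t := U)
    (f := fun a => ((fun i => ⌊(y a i : ℝ) / X ^ r i⌋), (fun j => decide (0 ≤ e a j))))
    (by rw [hUc, Nat.card_Icc]; omega) (by
      intro a ha
      simp only [hU, Finset.mem_coe, Finset.mem_product, Fintype.mem_piFinset, Finset.mem_univ,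
        and_true, Finset.mem_Icc]
      intro i
      have h1 := abs_lt.1 (hsmall a ha i)
      constructor
      · rw [Int.le_floor, le_div_iff₀ (hXr i)]
        push_cast
        linarith
      · have : ⌊(y a i : ℝ) / X ^ r i⌋ < 2 := by
          rw [Int.floor_lt, div_lt_iff₀ (hXr i)]
          push_cast
          linarith
        omega)
  simp only [Prod.mk.injEq] at hfab
  have hz : (fun i => y a i - y b i) ≠ 0 := by
    intro h0
    apply hab
    apply hYmono.injective
    rw [hY, hY]
    congr 1
    funext i
    have := congrFun h0 i
    simp at this
    have : y a i = y b i := by omega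
    rw [this]
  have h1 := hbest k _ hz (by
    rw [← hX, qnorm_lt_iff hm r hrpos _ _ hXpos.le]
    intro i
    have h2 := Int.abs_sub_lt_one_of_floor_eq_floor (congrFun hfab.1 i)
    rw [← sub_div, abs_div, abs_of_pos (hXr i), div_lt_one (hXr i)] at h2
    push_cast
    exact h2)
  have h2 : idist hn s (fun j => ∑ i, A i j * ((y a i - y b i : ℤ) : ℝ)) ≤ M (k+1) := by
    refine (idist_le hn s _ (fun j => round (x a j) - round (x b j))).trans ?_
    rw [qnorm_le_iff hn s hspos _ _ hM0]
    intro j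
    rw [sum_sub_eq A (y a) (y b) j]
    have h4 : (∑ i, A i j * (y a i : ℝ)) - (∑ i, A i j * (y b i : ℝ))
        - ((round (x a j) - round (x b j) : ℤ) : ℝ) = e a j - e b j := by
      simp only [he, hx]
      push_cast
      ring
    rw [h4]
    have h5 := abs_le.1 (hesmall a ha j)
    have h6 := abs_le.1 (hesmall b hb j)
    have h7 : (0 ≤ e a j) ↔ (0 ≤ e b j) := decide_eq_decide.1 (congrFun hfab.2 j)
    rw [abs_le]
    by_cases h8 : 0 ≤ e a j
    · have := h7.1 h8
      constructor <;> linarith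
    · have h9 : ¬ 0 ≤ e b j := fun h => h8 (h7.2 h)
      push Not at h8 h9
      constructor <;> linarith
  have h3 : M (k+1) < M k := hManti (Nat.lt_succ_self k)
  linarith

/-- `A^T` is singular on average iff for every `ε > 0` the indices `i ≤ k` with
`M_i Y_{i+1} > ε` have vanishing density relative to `log Y_k`. -/
theorem transpose_singularOnAverage_iff_density {m n : ℕ} (hm : 0 < m) (hn : 0 < n)
    (r : Fin m → ℝ) (s : Fin n → ℝ)
    (hrpos : ∀ i, 0 < r i) (hspos : ∀ j, 0 < s j)
    (hrsum : ∑ i, r i = 1) (hssum : ∑ j, s j = 1)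
    (A : Matrix (Fin m) (Fin n) ℝ)
    -- `rank_ℤ(A^T ℤ^m + ℤ^n) = m + n`
    (hrank : ∀ (y : Fin m → ℤ) (q : Fin n → ℤ),
      (∀ j, (∑ i, A i j * (y i : ℝ)) + (q j : ℝ) = 0) → y = 0 ∧ q = 0)
    -- the sequence of weighted best approximations to `A^T`
    (y : ℕ → Fin m → ℤ) (hy0 : ∀ k, y k ≠ 0)
    (Y M : ℕ → ℝ)
    (hY : ∀ k, Y k = qnorm hm r (fun i => (y k i : ℝ)))
    (hM : ∀ k, M k = idist hn s (fun j => ∑ i, A i j * (y k i : ℝ)))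
    (hYmono : StrictMono Y) (hManti : StrictAnti M)
    (hbest : ∀ k, ∀ z : Fin m → ℤ, z ≠ 0 →
      qnorm hm r (fun i => (z i : ℝ)) < Y (k + 1) →
      M k ≤ idist hn s (fun j => ∑ i, A i j * (z i : ℝ))) :
    SingularOnAverage hn hm s r A.transpose ↔
      ∀ ε : ℝ, 0 < ε →
        Filter.Tendsto (fun k : ℕ =>
          (({i : ℕ | 1 ≤ i ∧ i ≤ k ∧ ε < M i * Y (i + 1)}.ncard : ℝ) / Real.log (Y k)))
          Filter.atTop (𝓝 0) := by
  have hYone : ∀ k, 1 ≤ Y k := fun k => by rw [hY]; exact one_le_qnorm hm r hrpos _ (hy0 k)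
  have hMpos : ∀ k, 0 < M k := fun k => by
    have h1 : M (k+1) < M k := hManti (Nat.lt_succ_self k)
    have h2 : 0 ≤ M (k+1) := by rw [hM]; exact idist_nonneg _ _ _
    linarith
  have hdoub := doubling hm hn r s hrpos hspos hrsum A y hy0 Y M hY hM hYmono hManti hbest
  have hYtop : Tendsto Y atTop atTop := by
    refine tendsto_atTop_atTop_of_monotone hYmono.monotone fun b => ?_
    have hpow : ∀ j : ℕ, (2:ℝ) ^ j ≤ Y (1 + j * (4 ^ m * 2 ^ n)) := by
      intro j
      induction j with
      | zero => simpa using hYone _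
      | succ j ih =>
        have := hdoub (j * (4 ^ m * 2 ^ n))
        rw [show 1 + (j+1) * (4 ^ m * 2 ^ n) = j * (4 ^ m * 2 ^ n) + 1 + 4 ^ m * 2 ^ n by ring,
          pow_succ]
        rw [add_comm 1] at ih
        linarith
    obtain ⟨j, hj⟩ := pow_unbounded_of_one_lt b (one_lt_two : (1:ℝ) < 2)
    exact ⟨_, hj.le.trans (hpow j)⟩
  have hC : ∀ k, M k * Y (k+1) ≤ 2 ^ (n+1) := by
    intro k
    have hM1 : M k ≤ 1 := by rw [hM]; exact idist_le_one hn s hspos _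
    have hYp := hYone (k+1)
    have h2n : (0:ℝ) < 2 ^ n := by positivity
    by_cases hc : Y (k+1) ≤ 2 ^ (n+1)
    · nlinarith [hMpos k]
    · push Not at hc
      have hδ : 0 < 2 ^ (n+1) / Y (k+1) := by positivity
      obtain ⟨z, hz0, hz1, hz2⟩ := dirichlet hm hn r s hrpos hspos hrsum hssum A
        (Y (k+1) / 2) (2 ^ (n+1) / Y (k+1)) (by positivity) hδ
        ((div_le_one (by positivity)).2 hc.le) (by
          apply le_of_eq
          field_simp
          ring)
      have := (hbest k z hz0 (by linarith)).trans hz2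
      rwa [le_div_iff₀ (by positivity)] at this
  have hmul : ∀ (a ε : ℝ) (l : ℕ), a < ε * 2 ^ (-(l:ℝ)) ↔ a * 2 ^ l < ε := by
    intro a ε l
    rw [Real.rpow_neg (by norm_num), Real.rpow_natCast, ← div_eq_mul_inv,
      lt_div_iff₀ (by positivity)]
  unfold SingularOnAverage
  simp only [Matrix.transpose_apply]
  refine abstract_iff Y M hYmono (hYone 0) hYtop hMpos (2 ^ (n+1)) hC (4 ^ m * 2 ^ n) hdoub
    (fun ε l => ∃ q : Fin m → ℤ,
      idist hn s (fun i => ∑ j, A j i * (q j : ℝ)) < ε * 2 ^ (-(l : ℝ)) ∧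
      0 < qnorm hm r (fun j => (q j : ℝ)) ∧
      qnorm hm r (fun j => (q j : ℝ)) < 2 ^ (l : ℝ)) ?_ ?_
  · rintro ε l i hl ⟨q, hq1, hq2, hq3⟩
    rw [Real.rpow_natCast] at hq3
    have hq0 : q ≠ 0 := by
      rintro rfl
      refine absurd hq2 (not_lt.2 ?_)
      rw [qnorm_le_iff hm r hrpos _ _ le_rfl]
      intro i
      simp [Real.zero_rpow (hrpos i).ne']
    rw [← hmul]
    exact (hbest i q hq0 (hq3.trans_le hl)).trans_lt hq1
  · intro ε l i hl hMl
    refine ⟨y i, ?_, ?_, ?_⟩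
    · rw [← hM, hmul]
      exact hMl
    · rw [← hY]
      linarith [hYone i]
    · rw [← hY, Real.rpow_natCast]
      exact hl
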